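/- Let d ≥ 1, κ_1,…,κ_d > 0, and λ_κ = Σ_{j=1}^d κ_j. Then for every t > 0, every y ∈ ℝ^d, and every x ∈ ℝ^d with x_j ≠ 0 for all j, the Dunkl heat kernel p_t satisfies −Δ_κ(log p_t(·,y))(x) ≤ (d + 2λ_κ)/(2t). -/

import Mathlib

open Real MeasureTheory

/-- Partial derivative `∂f/∂x_j` at `x`. -/
noncomputable def pd {d : ℕ} (f : (Fin d → ℝ) → ℝ) (j : Fin d) (x : Fin d → ℝ) : ℝ :=
  deriv (fun s => f (Function.update x j s)) (x j)

/-- The `ℤ₂^d` Dunkl Laplacian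
`Δ_κ f(x) = Σ_j [ ∂²_j f(x) + (κ_j/x_j²)(2 x_j ∂_j f(x) − f(x) + f(σ_j x)) ]`. -/
noncomputable def dunklLapZ2 {d : ℕ} (κ : Fin d → ℝ) (f : (Fin d → ℝ) → ℝ)
    (x : Fin d → ℝ) : ℝ :=
  ∑ j, (pd (fun z => pd f j z) j x
    + κ j / (x j) ^ 2 * (2 * x j * pd f j x - f x + f (Function.update x j (-(x j)))))

/-- The one-dimensional Dunkl heat kernel
`p_t^{(κ)}(u,v) = (Γ(κ+1/2)(2t)^{κ+1/2})⁻¹ exp(−(u²+v²)/(4t)) ·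
  (Γ(κ+1/2)/(√π Γ(κ))) ∫_{−1}^{1} (1−s)^{κ−1}(1+s)^{κ} exp(suv/(2t)) ds`. -/
noncomputable def pKer (κ t u v : ℝ) : ℝ :=
  (Real.Gamma (κ + 1/2) * (2*t) ^ (κ + 1/2))⁻¹ * Real.exp (-(u^2 + v^2) / (4*t))
    * (Real.Gamma (κ + 1/2) / (Real.sqrt π * Real.Gamma κ))
    * ∫ s in (-1 : ℝ)..(1 : ℝ),
        (1 - s) ^ (κ - 1) * (1 + s) ^ κ * Real.exp (s * u * v / (2*t))

/-- The Dunkl heat kernel in the `ℤ₂^d` case: `p_t(x,y) = ∏_j p_t^{(κ_j)}(x_j,y_j)`. -/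
noncomputable def pHeat {d : ℕ} (κ : Fin d → ℝ) (t : ℝ) (x y : Fin d → ℝ) : ℝ :=
  ∏ j, pKer (κ j) t (x j) (y j)

open ProbabilityTheory

/-- The measure on `[-1, 1]` with density `(1 - s)^(κ-1) (1 + s)^κ`, whose moment generating
function is, up to a constant, the one-dimensional Dunkl kernel. -/
noncomputable def dunklMeasure (κ : ℝ) : Measure ℝ :=
  (volume.restrict (Set.Ioc (-1) 1)).withDensity
    fun s => ENNReal.ofReal ((1 - s) ^ (κ - 1) * (1 + s) ^ κ)

lemma intervalIntegrable_dunklWeight {κ : ℝ} (hκ : 0 < κ) :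
    IntervalIntegrable (fun s : ℝ => (1 - s) ^ (κ - 1) * (1 + s) ^ κ) volume (-1) 1 := by
  have h : IntervalIntegrable (fun s : ℝ => (1 - s) ^ (κ - 1)) volume (-1) 1 := by
    have h₀ : IntervalIntegrable (fun s : ℝ => s ^ (κ - 1)) volume 2 0 :=
      intervalIntegral.intervalIntegrable_rpow' (by linarith)
    have h₁ := h₀.comp_sub_left 1
    norm_num at h₁
    exact h₁
  refine h.mul_continuousOn (Continuous.continuousOn ?_)
  exact (continuous_const.add continuous_id).rpow_const fun _ => Or.inr hκ.le

lemma isFiniteMeasure_dunklMeasure {κ : ℝ} (hκ : 0 < κ) : IsFiniteMeasure (dunklMeasure κ) :=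
  isFiniteMeasure_withDensity_ofReal
    ((intervalIntegrable_iff_integrableOn_Ioc_of_le (by norm_num)).1
      (intervalIntegrable_dunklWeight hκ)).2

lemma mgf_dunklMeasure (κ z : ℝ) :
    mgf id (dunklMeasure κ) z
      = ∫ s in (-1 : ℝ)..1, (1 - s) ^ (κ - 1) * (1 + s) ^ κ * Real.exp (z * s) := by
  rw [mgf, dunklMeasure, integral_withDensity_eq_integral_toReal_smul (by fun_prop) (by simp),
    intervalIntegral.integral_of_le (by norm_num)]
  refine setIntegral_congr_fun measurableSet_Ioc fun s hs => ?_
  have h₁ : 0 ≤ 1 - s := by linarith [hs.2]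
  have h₂ : 0 ≤ 1 + s := by linarith [hs.1]
  have : 0 ≤ (1 - s) ^ (κ - 1) * (1 + s) ^ κ := by positivity
  simp [ENNReal.toReal_ofReal this]

lemma dunklMeasure_ne_zero {κ : ℝ} (hκ : 0 < κ) : dunklMeasure κ ≠ 0 := by
  intro h
  have h₀ := mgf_dunklMeasure κ 0
  simp only [h, mgf_zero_measure, Pi.zero_apply, zero_mul, Real.exp_zero, mul_one] at h₀
  refine h₀.not_lt (intervalIntegral.intervalIntegral_pos_of_pos_on
    (intervalIntegrable_dunklWeight hκ) (fun s hs => ?_) (by norm_num))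
  have h₁ : 0 < 1 - s := by linarith [hs.2]
  have h₂ : 0 < 1 + s := by linarith [hs.1]
  positivity

lemma integrable_exp_mul_dunklMeasure {κ : ℝ} (hκ : 0 < κ) (z : ℝ) :
    Integrable (fun s => Real.exp (z * id s)) (dunklMeasure κ) := by
  have := isFiniteMeasure_dunklMeasure hκ
  refine integrable_exp_mul_of_mem_Icc (a := -1) (b := 1) aemeasurable_id ?_
  refine (withDensity_absolutelyContinuous _ _).ae_le ?_
  filter_upwards [ae_restrict_mem measurableSet_Ioc] with s hs
  exact Set.Ioc_subset_Icc_self hs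

lemma interior_integrableExpSet_dunklMeasure {κ : ℝ} (hκ : 0 < κ) :
    interior (integrableExpSet id (dunklMeasure κ)) = Set.univ := by
  have h : integrableExpSet id (dunklMeasure κ) = Set.univ :=
    Set.eq_univ_of_forall fun z => integrable_exp_mul_dunklMeasure hκ z
  rw [h, interior_univ]

lemma contDiff_cgf_dunklMeasure {κ : ℝ} (hκ : 0 < κ) :
    ContDiff ℝ 2 (cgf id (dunklMeasure κ)) :=
  contDiff_iff_contDiffAt.2 fun z => (analyticAt_cgf
    (by simp [interior_integrableExpSet_dunklMeasure hκ])).contDiffAt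

lemma convexOn_cgf_dunklMeasure {κ : ℝ} (hκ : 0 < κ) :
    ConvexOn ℝ Set.univ (cgf id (dunklMeasure κ)) := by
  have h := contDiff_cgf_dunklMeasure hκ
  refine convexOn_univ_of_deriv2_nonneg (h.differentiable (by norm_num))
    (h.differentiable_deriv_two) fun z => ?_
  rw [← iteratedDeriv_eq_iterate, ← variance_tilted_mul
    (by simp [interior_integrableExpSet_dunklMeasure hκ])]
  exact variance_nonneg _ _

lemma pKer_eq (κ t u v : ℝ) :
    pKer κ t u v = (Real.Gamma (κ + 1/2) * (2*t) ^ (κ + 1/2))⁻¹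
      * Real.exp (-(u^2 + v^2) / (4*t)) * (Real.Gamma (κ + 1/2) / (Real.sqrt π * Real.Gamma κ))
      * mgf id (dunklMeasure κ) (v / (2*t) * u) := by
  rw [mgf_dunklMeasure, pKer]
  congr! 5 with s
  ring

lemma pKer_pos {κ t : ℝ} (hκ : 0 < κ) (ht : 0 < t) (u v : ℝ) : 0 < pKer κ t u v := by
  have := mgf_pos' (dunklMeasure_ne_zero hκ) (integrable_exp_mul_dunklMeasure hκ (v / (2*t) * u))
  have := Real.Gamma_pos_of_pos hκ
  have := Real.Gamma_pos_of_pos (show 0 < κ + 1/2 by linarith)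
  rw [pKer_eq]
  positivity

lemma exists_log_pKer_eq {κ t : ℝ} (hκ : 0 < κ) (ht : 0 < t) (v : ℝ) :
    ∃ C, ∀ u, Real.log (pKer κ t u v)
      = C - u^2 / (4*t) + cgf id (dunklMeasure κ) (v / (2*t) * u) := by
  have hG := Real.Gamma_pos_of_pos hκ
  have hG' := Real.Gamma_pos_of_pos (show 0 < κ + 1/2 by linarith)
  refine ⟨Real.log (Real.Gamma (κ + 1/2) * (2*t) ^ (κ + 1/2))⁻¹ - v^2 / (4*t)
    + Real.log (Real.Gamma (κ + 1/2) / (Real.sqrt π * Real.Gamma κ)), fun u => ?_⟩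
  have hm := mgf_pos' (dunklMeasure_ne_zero hκ)
    (integrable_exp_mul_dunklMeasure hκ (v / (2*t) * u))
  rw [pKer_eq, Real.log_mul (by positivity) hm.ne', Real.log_mul (by positivity) (by positivity),
    Real.log_mul (by positivity) (by positivity), Real.log_exp, cgf]
  ring

lemma ConvexOn.add_deriv_mul_sub_le {M : ℝ → ℝ} (hM : ConvexOn ℝ Set.univ M) {x : ℝ}
    (hd : DifferentiableAt ℝ M x) (y : ℝ) : M x + deriv M x * (y - x) ≤ M y := by
  rcases lt_trichotomy x y with h | rfl | h
  · have := hM.deriv_le_slope (Set.mem_univ x) (Set.mem_univ y) h hd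
    rw [slope_def_field, le_div_iff₀ (by linarith)] at this
    linarith
  · simp
  · have := hM.slope_le_deriv (Set.mem_univ y) (Set.mem_univ x) h hd
    rw [slope_def_field, div_le_iff₀ (by linarith)] at this
    linarith

lemma neg_dunklLap_le_of_convexOn {κ t C x : ℝ} (hκ : 0 ≤ κ) (hx : x ≠ 0) {g M : ℝ → ℝ}
    (hM : ConvexOn ℝ Set.univ M) (hd : ContDiff ℝ 2 M) (hg : ∀ u, g u = C - u^2 / (4*t) + M u) :
    -(deriv (deriv g) x + κ / x^2 * (2 * x * deriv g x - g x + g (-x)))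
      ≤ (1 + 2 * κ) / (2*t) := by
  have hg₁ : deriv g = fun u => -(u / (2*t)) + deriv M u := by
    ext u
    have h : HasDerivAt (fun u => C - u^2 / (4*t) + M u)
        (-(2 * u / (4*t)) + deriv M u) u := by
      refine HasDerivAt.fun_add ?_ (hd.differentiable (by norm_num) u).hasDerivAt
      simpa using ((hasDerivAt_pow 2 u).div_const (4*t)).const_sub C
    rw [funext hg, h.deriv]
    ring
  have hg₂ : deriv (deriv g) x = -(1 / (2*t)) + deriv (deriv M) x := by
    rw [hg₁]
    exact (((hasDerivAt_id x).div_const (2*t)).neg.add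
      (hd.differentiable_deriv_two x).hasDerivAt).deriv
  have hM₂ : 0 ≤ deriv (deriv M) x := by
    have := hM.monotoneOn_deriv fun u _ => (hd.differentiable (by norm_num)) u
    exact (monotoneOn_univ.1 this).deriv_nonneg
  have htan := hM.add_deriv_mul_sub_le (hd.differentiable (by norm_num) x) (-x)
  have hnn : 0 ≤ κ / x^2 * (2 * x * deriv M x - M x + M (-x)) :=
    mul_nonneg (by positivity) (by linarith)
  have hid : deriv (deriv g) x + κ / x^2 * (2 * x * deriv g x - g x + g (-x))
      = deriv (deriv M) x + κ / x^2 * (2 * x * deriv M x - M x + M (-x))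
        - (1 + 2 * κ) / (2*t) := by
    rw [hg₂, hg₁, hg, hg]
    field_simp
    ring
  linarith

lemma sum_update_eq {d : ℕ} (G : Fin d → ℝ → ℝ) (x : Fin d → ℝ) (j : Fin d) (s : ℝ) :
    ∑ i, G i (Function.update x j s i) = G j s + ∑ i ∈ Finset.univ.erase j, G i (x i) := by
  rw [← Finset.add_sum_erase _ _ (Finset.mem_univ j), Function.update_self]
  congr 1
  exact Finset.sum_congr rfl fun i hi => by rw [Function.update_of_ne (Finset.ne_of_mem_erase hi)]

lemma dunklLapZ2_sum {d : ℕ} (κ : Fin d → ℝ) (G : Fin d → ℝ → ℝ) (x : Fin d → ℝ) :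
    dunklLapZ2 κ (fun z => ∑ i, G i (z i)) x
      = ∑ j, (deriv (deriv (G j)) (x j)
        + κ j / (x j) ^ 2 * (2 * x j * deriv (G j) (x j) - G j (x j) + G j (-(x j)))) := by
  have hpd : ∀ j z, pd (fun z => ∑ i, G i (z i)) j z = deriv (G j) (z j) := fun j z => by
    simp only [pd, sum_update_eq, deriv_add_const]
  refine Finset.sum_congr rfl fun j _ => ?_
  simp only [hpd, sum_update_eq]
  simp only [pd, Function.update_self]
  rw [← Finset.add_sum_erase _ (fun i => G i (x i)) (Finset.mem_univ j)]
  ring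

/-- **Sharp Li–Yau inequality for the Dunkl heat kernel** (`ℤ₂^d` case): for `t > 0`,
`y ∈ ℝ^d` and `x` with all coordinates nonzero,
`−Δ_κ(log p_t(·,y))(x) ≤ (d + 2λ_κ)/(2t)`. -/
theorem stmt10 (d : ℕ) (hd : 1 ≤ d) (κ : Fin d → ℝ) (hκ : ∀ j, 0 < κ j)
    (lamκ : ℝ) (hlam : lamκ = ∑ j, κ j)
    (t : ℝ) (ht : 0 < t) (y : Fin d → ℝ) (x : Fin d → ℝ) (hx : ∀ j, x j ≠ 0) :
    -dunklLapZ2 κ (fun z => Real.log (pHeat κ t z y)) x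
      ≤ ((d : ℝ) + 2 * lamκ) / (2*t) := by
  have hlog : (fun z => Real.log (pHeat κ t z y))
      = fun z => ∑ i, (fun u => Real.log (pKer (κ i) t u (y i))) (z i) := by
    ext z
    exact Real.log_prod fun i _ => (pKer_pos (hκ i) ht _ _).ne'
  have hsum : ((d : ℝ) + 2 * lamκ) / (2*t) = ∑ j, (1 + 2 * κ j) / (2*t) := by
    simp [hlam, ← Finset.sum_div, Finset.sum_add_distrib, Finset.mul_sum]
  rw [hlog, dunklLapZ2_sum κ (fun i u => Real.log (pKer (κ i) t u (y i))), hsum,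
    ← Finset.sum_neg_distrib]
  refine Finset.sum_le_sum fun j _ => ?_
  obtain ⟨C, hC⟩ := exists_log_pKer_eq (hκ j) ht (y j)
  refine neg_dunklLap_le_of_convexOn (hκ j).le (hx j) ?_ ?_ hC
  · exact (convexOn_cgf_dunklMeasure (hκ j)).comp_linearMap (LinearMap.mulLeft ℝ (y j / (2*t)))
  · exact (contDiff_cgf_dunklMeasure (hκ j)).comp (contDiff_const.mul contDiff_id)
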